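/- Let $\Omega = \{x = (x_1,x_2) \in \mathbb{R}^2 : |x_1| = |x_2| > 0\}$, and for $x \in \Omega$ let $\mathbb{P}_x$ assign mass $\tfrac{1}{4}$ to each of $(x_1,x_2)$, $(-x_1,x_2)$, $(x_1,-x_2)$, $(-x_1,-x_2)$. Let $R_1(x) = (x_1,-x_2)$, $A_{1x} = \{x, R_1(x)\}$, $R_2(x) = (-x_1,x_2)$, $A_{2x} = \{x, R_2(x)\}$, let $\mathcal{G}_i$ be the $\sigma$-field generated by $\{A_{ix} : x \in \Omega\}$ ($i=1,2$), let $\mathcal{G} = \sigma(\mathcal{G}_1 \cup \mathcal{G}_2)$, let $D = \{x \in \Omega : x_1 = x_2\}$, and let $\mathcal{F} = \sigma(\mathcal{G} \cup \{D\})$. Then, with respect to the family $\{\mathbb{P}_x\}_{x \in \Omega}$ on $(\Omega,\mathcal{F})$, both $\mathcal{G}_1$ and $\mathcal{G}_2$ are sufficient sub-$\sigma$-fields of $\mathcal{F}$. -/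

import Mathlib

open MeasureTheory
open scoped ENNReal

/-- A sub-σ-field `G` of `m0` is sufficient for the family of probability measures `P`
if for every bounded `m0`-measurable `f` there is a `G`-measurable `g` (integrable for
each `P γ`) with `∫_s f dP γ = ∫_s g dP γ` for all `γ` and all `G`-measurable `s`,
i.e. `g` is a version of `E_γ[f | G]` simultaneously for all `γ`. -/
def IsSufficient {Ω Γ : Type*} (m0 : MeasurableSpace Ω)
    (P : Γ → @Measure Ω m0) (G : MeasurableSpace Ω) : Prop :=
  G ≤ m0 ∧
    ∀ f : Ω → ℝ, Measurable[m0] f → (∃ C : ℝ, ∀ ω, |f ω| ≤ C) →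
      ∃ g : Ω → ℝ, Measurable[G] g ∧ (∀ γ, Integrable g (P γ)) ∧
        ∀ γ, ∀ s : Set Ω, MeasurableSet[G] s →
          ∫ ω in s, f ω ∂(P γ) = ∫ ω in s, g ω ∂(P γ)

/-- The sample space `Ω = {x ∈ ℝ² : |x₁| = |x₂| > 0}`. -/
def Om : Type := {p : ℝ × ℝ // |p.1| = |p.2| ∧ p.1 ≠ 0}

/-- Reflection in the first coordinate axis: `R₁(x₁, x₂) = (x₁, -x₂)`. -/
def R1 (x : Om) : Om :=
  ⟨(x.1.1, -x.1.2), by simpa [abs_neg] using x.2⟩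

/-- Reflection in the second coordinate axis: `R₂(x₁, x₂) = (-x₁, x₂)`. -/
def R2 (x : Om) : Om :=
  ⟨(-x.1.1, x.1.2), by simpa [abs_neg, neg_eq_zero] using x.2⟩

/-- `G₁` is generated by the pair sets `A₁ₓ = {x, R₁ x}`. -/
def G1 : MeasurableSpace Om :=
  MeasurableSpace.generateFrom {A : Set Om | ∃ x : Om, A = {x, R1 x}}

/-- `G₂` is generated by the pair sets `A₂ₓ = {x, R₂ x}`. -/
def G2 : MeasurableSpace Om :=
  MeasurableSpace.generateFrom {A : Set Om | ∃ x : Om, A = {x, R2 x}}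

/-- `G = σ(G₁ ∪ G₂)`. -/
def Gu : MeasurableSpace Om := G1 ⊔ G2

/-- The diagonal `D = {x ∈ Ω : x₁ = x₂}`. -/
def D : Set Om := {x : Om | x.1.1 = x.1.2}

/-- `F = σ(G ∪ {D})`. -/
def F : MeasurableSpace Om := Gu ⊔ MeasurableSpace.generateFrom {D}

/-- `P x` puts mass `1/4` on each of `(x₁,x₂)`, `(-x₁,x₂)`, `(x₁,-x₂)`, `(-x₁,-x₂)`. -/
noncomputable def P (x : Om) : @Measure Om F :=
  (4 : ℝ≥0∞)⁻¹ • (@Measure.dirac Om F x + @Measure.dirac Om F (R2 x) +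
    @Measure.dirac Om F (R1 x) + @Measure.dirac Om F (R1 (R2 x)))

/-- The sets whose indicator is constant on `T` and on `Tᶜ` outside a countable set. -/
@[reducible] def piecewiseCountableCocountable {α : Type*} (T : Set α) : MeasurableSpace α where
  MeasurableSet' A := ∃ N : Set α, N.Countable ∧
    ∀ x ∉ N, ∀ y ∉ N, (x ∈ T ↔ y ∈ T) → (x ∈ A ↔ y ∈ A)
  measurableSet_empty := ⟨∅, Set.countable_empty, by simp⟩
  measurableSet_compl := by
    rintro A ⟨N, hN, h⟩
    exact ⟨N, hN, fun x hx y hy hT => not_congr (h x hx y hy hT)⟩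
  measurableSet_iUnion := by
    intro A hA
    choose N hN h using hA
    refine ⟨⋃ i, N i, Set.countable_iUnion hN, fun x hx y hy hT => ?_⟩
    simp only [Set.mem_iUnion, not_exists] at hx hy ⊢
    exact exists_congr fun i => h i x (hx i) y (hy i) hT

lemma measurableSet_piecewise_of_countable {α : Type*} (T : Set α) {A : Set α}
    (hA : A.Countable) : MeasurableSet[piecewiseCountableCocountable T] A :=
  ⟨A, hA, fun _ hx _ hy _ => by simp [hx, hy]⟩

lemma F_le_piecewiseCountableCocountable : F ≤ piecewiseCountableCocountable D := by
  refine sup_le (sup_le ?_ ?_) ?_ <;> apply MeasurableSpace.generateFrom_le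
  · rintro _ ⟨x, rfl⟩
    exact measurableSet_piecewise_of_countable D (Set.toFinite _).countable
  · rintro _ ⟨x, rfl⟩
    exact measurableSet_piecewise_of_countable D (Set.toFinite _).countable
  · rintro _ rfl
    exact ⟨∅, Set.countable_empty, fun _ _ _ _ h => h⟩

/-- A real function measurable for `piecewiseCountableCocountable T` is constant on `T` and
on `Tᶜ` outside a countable set. -/
lemma exists_countable_eq_of_measurable {α : Type*} {T : Set α} {f : α → ℝ}
    (hf : Measurable[piecewiseCountableCocountable T] f) :
    ∃ N : Set α, N.Countable ∧ ∀ x ∉ N, ∀ y ∉ N, (x ∈ T ↔ y ∈ T) → f x = f y := by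
  have h (q : ℚ) : MeasurableSet[piecewiseCountableCocountable T] (f ⁻¹' Set.Iio (q : ℝ)) :=
    hf measurableSet_Iio
  choose N hN h using h
  refine ⟨⋃ q, N q, Set.countable_iUnion hN, fun x hx y hy hT => ?_⟩
  simp only [Set.mem_iUnion, not_exists] at hx hy
  have key (q : ℚ) : f x < q ↔ f y < q := h q x (hx q) y (hy q) hT
  rcases lt_trichotomy (f x) (f y) with hlt | heq | hlt
  · obtain ⟨q, h1, h2⟩ := exists_rat_btwn hlt
    exact absurd ((key q).1 h1) h2.not_gt
  · exact heq
  · obtain ⟨q, h1, h2⟩ := exists_rat_btwn hlt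
    exact absurd ((key q).2 h1) h2.not_gt

section Orbits

variable {α : Type*} {R : α → α}

lemma mem_iff_of_measurableSet_generateFrom_pairs (hR : Function.Involutive R) {s : Set α}
    (hs : MeasurableSet[MeasurableSpace.generateFrom {A : Set α | ∃ x, A = {x, R x}}] s)
    (x : α) : R x ∈ s ↔ x ∈ s := by
  induction s, hs using MeasurableSpace.generateFrom_induction with
  | hC t ht _ =>
    obtain ⟨y, rfl⟩ := ht
    simp only [Set.mem_insert_iff, Set.mem_singleton_iff, hR.injective.eq_iff, hR.eq_iff]
    tauto
  | empty => simp
  | compl t _ ih => exact not_congr ih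
  | iUnion t _ ih => simp [ih]

lemma measurableSet_generateFrom_pairs_of_countable {s : Set α} (hs : s.Countable)
    (hinv : ∀ x ∈ s, R x ∈ s) :
    MeasurableSet[MeasurableSpace.generateFrom {A : Set α | ∃ x, A = {x, R x}}] s := by
  have : s = ⋃ x ∈ s, {x, R x} := by
    ext y
    simp only [Set.mem_iUnion, Set.mem_insert_iff, Set.mem_singleton_iff, exists_prop]
    constructor
    · exact fun hy => ⟨y, hy, Or.inl rfl⟩
    · rintro ⟨x, hx, rfl | rfl⟩
      exacts [hx, hinv x hx]
  rw [this]
  exact MeasurableSet.biUnion hs fun x _ => MeasurableSpace.measurableSet_generateFrom ⟨x, rfl⟩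

lemma measurable_generateFrom_pairs {g : α → ℝ} (hR : ∀ x, g (R x) = g x)
    {N : Set α} (hN : N.Countable) (hg : ∀ x ∉ N, ∀ y ∉ N, g x = g y) :
    Measurable[MeasurableSpace.generateFrom {A : Set α | ∃ x, A = {x, R x}}] g := by
  intro B _
  by_cases h : g ⁻¹' B ⊆ N
  · exact measurableSet_generateFrom_pairs_of_countable (hN.mono h) fun x hx => by
      simpa [hR] using hx
  · obtain ⟨y, hyB, hyN⟩ := Set.not_subset.1 h
    refine MeasurableSet.of_compl (measurableSet_generateFrom_pairs_of_countable
      (hN.mono fun x hx => ?_) fun x hx => by simpa [hR] using hx)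
    by_contra hxN
    exact hx (show g x ∈ B from hg y hyN x hxN ▸ hyB)

end Orbits

lemma involutive_R1 : Function.Involutive R1 := fun x => Subtype.ext (by simp [R1])

lemma involutive_R2 : Function.Involutive R2 := fun x => Subtype.ext (by simp [R2])

lemma R1_R2 (x : Om) : R1 (R2 x) = R2 (R1 x) := rfl

lemma eq_neg_of_notMem_D {x : Om} (hx : x ∉ D) : x.1.1 = -x.1.2 :=
  (abs_eq_abs.1 x.2.1).resolve_left hx

lemma R1_mem_D (x : Om) : R1 x ∈ D ↔ x ∉ D := by
  refine ⟨fun h hx => x.2.2 ?_, eq_neg_of_notMem_D⟩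
  change x.1.1 = -x.1.2 at h
  change x.1.1 = x.1.2 at hx
  linarith

lemma R2_mem_D (x : Om) : R2 x ∈ D ↔ x ∉ D := by
  rw [← R1_mem_D]
  exact neg_eq_iff_eq_neg

lemma measurableSet_singleton_F (x : Om) : MeasurableSet[F] {x} := by
  have h1 : MeasurableSet[F] {x, R1 x} :=
    (le_sup_left.trans le_sup_left : G1 ≤ F) _
      (MeasurableSpace.measurableSet_generateFrom ⟨x, rfl⟩)
  have h2 : MeasurableSet[F] {x, R2 x} :=
    (le_sup_right.trans le_sup_left : G2 ≤ F) _
      (MeasurableSpace.measurableSet_generateFrom ⟨x, rfl⟩)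
  convert h1.inter h2 using 1
  ext y
  simp only [Set.mem_singleton_iff, Set.mem_inter_iff, Set.mem_insert_iff]
  refine ⟨fun h => ⟨Or.inl h, Or.inl h⟩, ?_⟩
  rintro ⟨h | h, h' | h'⟩
  · exact h
  · exact h
  · exact h'
  · have h0 : x.1.1 = -x.1.1 := congrArg (fun z : Om => z.1.1) (h.symm.trans h')
    exact absurd (by linarith) x.2.2

lemma isProbabilityMeasure_P (x : Om) : IsProbabilityMeasure (P x) := by
  let := F
  refine ⟨?_⟩
  simp only [P, Measure.smul_apply, Measure.add_apply, measure_univ, smul_eq_mul]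
  norm_num
  exact ENNReal.inv_mul_cancel (by simp) (by simp)

lemma integrable_P (x : Om) (h : Om → ℝ) : Integrable h (P x) := by
  let := F
  have : MeasurableSingletonClass Om := ⟨measurableSet_singleton_F⟩
  have hd (y : Om) : Integrable h (Measure.dirac y) := integrable_dirac enorm_lt_top
  exact ((((hd _).add_measure (hd _)).add_measure (hd _)).add_measure (hd _)).smul_measure
    (by simp)

lemma integral_P (x : Om) (h : Om → ℝ) :
    ∫ ω, h ω ∂(P x) = 4⁻¹ * (h x + h (R2 x) + h (R1 x) + h (R1 (R2 x))) := by
  let := F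
  have : MeasurableSingletonClass Om := ⟨measurableSet_singleton_F⟩
  have hd (y : Om) : Integrable h (Measure.dirac y) := integrable_dirac enorm_lt_top
  have h2 := (hd x).add_measure (hd (R2 x))
  have h3 := h2.add_measure (hd (R1 x))
  rw [P, integral_smul_measure, integral_add_measure h3 (hd _), integral_add_measure h2 (hd _),
    integral_add_measure (hd _) (hd _)]
  simp [integral_dirac]

/-- A reflection that swaps `D` with its complement and preserves every `P x` has a sufficient
orbit σ-field. -/
lemma isSufficient_generateFrom_pairs {R : Om → Om} (hR : Function.Involutive R)
    (hD : ∀ x, R x ∈ D ↔ x ∉ D)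
    (hP : ∀ x (h : Om → ℝ), ∫ ω, h (R ω) ∂(P x) = ∫ ω, h ω ∂(P x))
    (hle : MeasurableSpace.generateFrom {A : Set Om | ∃ x, A = {x, R x}} ≤ F) :
    IsSufficient F P (MeasurableSpace.generateFrom {A : Set Om | ∃ x, A = {x, R x}}) := by
  refine ⟨hle, fun f hf _ => ⟨fun x => (f x + f (R x)) / 2, ?_, fun x => integrable_P x _, ?_⟩⟩
  · obtain ⟨N, hN, hfN⟩ := exists_countable_eq_of_measurable
      (hf.mono F_le_piecewiseCountableCocountable le_rfl)
    refine measurable_generateFrom_pairs (N := N ∪ R ⁻¹' N) (fun x => ?_)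
      (hN.union (hN.preimage hR.injective)) fun x hx y hy => ?_
    · rw [hR x, add_comm]
    · simp only [Set.mem_union, Set.mem_preimage, not_or] at hx hy
      by_cases hT : x ∈ D ↔ y ∈ D
      · rw [hfN x hx.1 y hy.1 hT, hfN (R x) hx.2 (R y) hy.2 (by simp only [hD, hT])]
      · rw [hfN x hx.1 (R y) hy.2 (by rw [hD]; tauto),
          hfN (R x) hx.2 y hy.1 (by rw [hD]; tauto), add_comm]
  · intro x s hs
    rw [← integral_indicator (hle s hs), ← integral_indicator (hle s hs)]
    have hmem := mem_iff_of_measurableSet_generateFrom_pairs hR hs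
    have hg : (s.indicator fun ω => (f ω + f (R ω)) / 2) =
        fun ω => (s.indicator f ω + s.indicator f (R ω)) / 2 := by
      funext ω
      by_cases h : ω ∈ s <;> simp [hmem, h]
    rw [hg, integral_div, integral_add (integrable_P x _) (integrable_P x _),
      hP x (s.indicator f)]
    ring

/-- For the family `{P x}` on `(Ω, F)`, both `G₁` and `G₂` are sufficient
sub-σ-fields of `F`. -/
theorem G1_G2_sufficient :
    (∀ x : Om, IsProbabilityMeasure (P x)) ∧
      IsSufficient F P G1 ∧ IsSufficient F P G2 := by
  refine ⟨isProbabilityMeasure_P, ?_, ?_⟩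
  · refine isSufficient_generateFrom_pairs involutive_R1 R1_mem_D (fun x h => ?_)
      (le_sup_left.trans le_sup_left : G1 ≤ F)
    simp only [integral_P, involutive_R1 _]
    ring
  · refine isSufficient_generateFrom_pairs involutive_R2 R2_mem_D (fun x h => ?_)
      (le_sup_right.trans le_sup_left : G2 ≤ F)
    simp only [integral_P, R1_R2, involutive_R2 _]
    ring
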